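/- arXiv:1805.11405 — 3 statements merged into one kernel-verified Lean document; each statement's English description precedes it below -/
import Mathlib

section
/- (Low-degree polynomial approximation of ReLU) For every 0 < τ < 1/2 and integer d ≥ 7, there exists a polynomial p of degree at most d such that |p(x) − ReLU(x)| ≤ 7·√(d/(τπ))·e^{−√(πτd/4)} for all x ∈ [−1+τ, 0], and |p(x) − ReLU(x)| ≤ τ + √(4τ/(πd)) + 6·√(d/(τπ))·e^{−√(πτd/4)} for all x ∈ (0, 1−τ]. -/
open Polynomial in
lemma relu_antideriv (q : Polynomial ℝ) (n : ℕ) (hq : q.natDegree ≤ n) :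
    ∃ P : Polynomial ℝ, P.natDegree ≤ n + 1 ∧ derivative P = q := by
  refine ⟨∑ i ∈ Finset.range (n + 1), C (q.coeff i / (i + 1)) * X ^ (i + 1), ?_, ?_⟩
  · refine natDegree_sum_le_of_forall_le _ _ fun i hi => ?_
    refine (natDegree_C_mul_X_pow_le _ _).trans ?_
    have := Finset.mem_range.1 hi
    omega
  · conv_rhs => rw [q.as_sum_range_C_mul_X_pow' (n := n + 1) (by omega)]
    rw [derivative_sum]
    refine Finset.sum_congr rfl fun i _ => ?_
    rw [derivative_C_mul_X_pow]
    have : (i : ℝ) + 1 ≠ 0 := by positivity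
    simp [this]

lemma relu_mvt_ge (F : Polynomial ℝ) (c u v : ℝ) (huv : u ≤ v)
    (h : ∀ t, u ≤ t → t ≤ v → c ≤ F.derivative.eval t) :
    c * (v - u) ≤ F.eval v - F.eval u := by
  refine Convex.mul_sub_le_image_sub_of_le_deriv (convex_Icc u v) (f := fun x => F.eval x)
    F.continuous.continuousOn F.differentiable.differentiableOn ?_ u ⟨le_rfl, huv⟩ v
    ⟨huv, le_rfl⟩ huv
  intro x hx
  have hx := interior_subset hx
  rw [F.deriv]
  exact h x hx.1 hx.2

lemma relu_mvt_le (F : Polynomial ℝ) (c u v : ℝ) (huv : u ≤ v)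
    (h : ∀ t, u ≤ t → t ≤ v → F.derivative.eval t ≤ c) :
    F.eval v - F.eval u ≤ c * (v - u) := by
  have := relu_mvt_ge (-F) (-c) u v huv (fun t h1 h2 => by simpa using h t h1 h2)
  simp at this
  linarith

open Polynomial in
lemma relu_core (τ K : ℝ) (hτ0 : 0 < τ) (hτ : τ < 1 / 2) (hK : 0 < K) (q : Polynomial ℝ) (n : ℕ)
    (hn : q.natDegree ≤ n) (hq0 : ∀ t, 0 ≤ q.eval t)
    (hq1 : ∀ t, -1 + τ ≤ t → t ≤ 0 → q.eval t ≤ 1)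
    (hq2 : ∀ t, τ ≤ t → t ≤ 1 - τ → q.eval t ≤ 1)
    (hq3 : ∀ t, τ / 4 ≤ t → t ≤ 3 * τ / 4 → K ≤ q.eval t) :
    ∃ p : Polynomial ℝ, p.natDegree ≤ n + 2 ∧
      (∀ x ∈ Set.Icc (-1 + τ) (0 : ℝ), |p.eval x - max x 0| ≤ 2 / (τ * K)) ∧
      (∀ x ∈ Set.Ioc (0 : ℝ) (1 - τ), |p.eval x - max x 0| ≤ τ + 2 / (τ * K)) := by
  obtain ⟨P, hPd, hP⟩ := relu_antideriv q n hn
  have mono : ∀ u v, u ≤ v → P.eval u ≤ P.eval v := fun u v huv => by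
    have := relu_mvt_ge P 0 u v huv (fun t _ _ => by rw [hP]; exact hq0 t)
    linarith
  set Z := P.eval (1 - τ) - P.eval (-1 + τ) with hZ
  have hZK : τ * K / 2 ≤ Z := by
    have h1 := relu_mvt_ge P K (τ / 4) (3 * τ / 4) (by linarith)
      (fun t h1 h2 => by rw [hP]; exact hq3 t h1 h2)
    have h2 := mono (-1 + τ) (τ / 4) (by linarith)
    have h3 := mono (3 * τ / 4) (1 - τ) (by linarith)
    linarith
  have hZ0 : 0 < Z := lt_of_lt_of_le (by positivity) hZK
  have he : 1 / Z ≤ 2 / (τ * K) := by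
    rw [div_le_div_iff₀ hZ0 (by positivity)]; linarith
  set e := 1 / Z with hedef
  have he0 : 0 < e := by positivity
  have heZ : e * Z = 1 := by rw [hedef]; field_simp
  set R : Polynomial ℝ := C e * (P - C (P.eval (-1 + τ))) with hR
  have hRe : ∀ t, R.eval t = e * (P.eval t - P.eval (-1 + τ)) := fun t => by simp [hR]
  obtain ⟨S, hSd, hS⟩ := relu_antideriv R (n + 1)
    ((natDegree_C_mul_le _ _).trans ((natDegree_sub_C (p := P)).le.trans hPd))
  -- bounds on R
  have R0 : ∀ t, -1 + τ ≤ t → 0 ≤ R.eval t := fun t ht => by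
    rw [hRe]; exact mul_nonneg he0.le (by linarith [mono _ _ ht])
  have R1 : ∀ t, t ≤ 1 - τ → R.eval t ≤ 1 := fun t ht => by
    rw [hRe]
    refine le_trans ?_ heZ.le
    exact mul_le_mul_of_nonneg_left (by linarith [mono _ _ ht]) he0.le
  have R2 : ∀ t, -1 + τ ≤ t → t ≤ 0 → R.eval t ≤ e := fun t h1 h2 => by
    have := relu_mvt_le P 1 _ _ h1 (fun t' h1' h2' => by rw [hP]; exact hq1 t' h1' (by linarith))
    rw [hRe]; nlinarith
  have R3 : ∀ t, τ ≤ t → t ≤ 1 - τ → 1 - e ≤ R.eval t := fun t h1 h2 => by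
    have := relu_mvt_le P 1 _ _ h2 (fun t' h1' h2' => by rw [hP]; exact hq2 t' (by linarith) h2')
    rw [hRe]
    have h5 : e * (Z - 1) ≤ e * (P.eval t - P.eval (-1 + τ)) :=
      mul_le_mul_of_nonneg_left (by linarith) he0.le
    linarith
  have hSm : ∀ u v, -1 + τ ≤ u → u ≤ v → S.eval u ≤ S.eval v := fun u v hu huv => by
    have := relu_mvt_ge S 0 u v huv (fun t h1 _ => by rw [hS]; exact R0 t (by linarith))
    linarith
  have hSneg : ∀ x, -1 + τ ≤ x → x ≤ 0 → S.eval x - S.eval (-1 + τ) ≤ e := fun x h1 h2 => by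
    have := relu_mvt_le S e _ _ h1 (fun t h1' h2' => by rw [hS]; exact R2 t h1' (by linarith))
    nlinarith
  refine ⟨S - C (S.eval (-1 + τ)), (natDegree_sub_C (p := S)).le.trans hSd, ?_, ?_⟩
  · rintro x ⟨h1, h2⟩
    rw [max_eq_right h2, eval_sub, eval_C, sub_zero,
      abs_of_nonneg (by linarith [hSm _ _ le_rfl h1])]
    exact (hSneg x h1 h2).trans he
  · rintro x ⟨h1, h2⟩
    rw [max_eq_left h1.le, eval_sub, eval_C, abs_le]
    have h0 := hSneg 0 (by linarith) le_rfl
    constructor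
    · rcases le_total x τ with hx | hx
      · have := hSm (-1 + τ) x le_rfl (by linarith)
        linarith
      · have h3 := relu_mvt_ge S (1 - e) _ _ hx
          (fun t h1' h2' => by rw [hS]; exact R3 t h1' (by linarith))
        have h4 := hSm (-1 + τ) τ le_rfl (by linarith)
        nlinarith
    · have := relu_mvt_le S 1 _ _ h1.le (fun t h1' h2' => by rw [hS]; exact R1 t (by linarith))
      linarith

open Polynomial in
lemma relu_kernel (τ : ℝ) (hτ0 : 0 < τ) (hτ : τ < 1 / 2) (m : ℕ) :
    ∃ q : Polynomial ℝ, q.natDegree ≤ 4 * m ∧ (∀ t, 0 ≤ q.eval t) ∧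
    (∀ t, -1 + τ ≤ t → t ≤ 0 → q.eval t ≤ 1) ∧
    (∀ t, τ ≤ t → t ≤ 1 - τ → q.eval t ≤ 1) ∧
    (∀ t, τ / 4 ≤ t → t ≤ 3 * τ / 4 → Real.exp (m * τ) / 4 ≤ q.eval t) := by
  set φ : Polynomial ℝ := C (1 + τ ^ 2 / 2) - C 2 * (X - C (τ / 2)) ^ 2 with hφ
  have hφe : ∀ t, φ.eval t = 1 + τ ^ 2 / 2 - 2 * (t - τ / 2) ^ 2 := fun t => by simp [hφ]
  have hφd : φ.natDegree ≤ 2 := by rw [hφ]; compute_degree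
  have hqe : ∀ t, (((Chebyshev.T ℝ m).comp φ) ^ 2).eval t
      = ((Chebyshev.T ℝ m).eval (φ.eval t)) ^ 2 := fun t => by simp
  have small : ∀ y : ℝ, |y| ≤ 1 → ((Chebyshev.T ℝ m).eval y) ^ 2 ≤ 1 := fun y hy => by
    rw [sq_le_one_iff_abs_le_one]
    exact Chebyshev.abs_eval_T_real_le_one _ hy
  refine ⟨((Chebyshev.T ℝ m).comp φ) ^ 2, ?_, ?_, ?_, ?_, ?_⟩
  · refine natDegree_pow_le.trans ?_
    rw [natDegree_comp, Chebyshev.natDegree_T]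
    simp only [Int.natAbs_natCast]
    nlinarith
  · intro t; rw [hqe]; positivity
  · intro t h1 h2
    rw [hqe]; apply small
    rw [hφe, abs_le]
    constructor <;> nlinarith
  · intro t h1 h2
    rw [hqe]; apply small
    rw [hφe, abs_le]
    constructor <;> nlinarith
  · intro t h1 h2
    rw [hqe]
    set y := φ.eval t with hy
    have hy1 : 1 + 3 * τ ^ 2 / 8 ≤ y := by rw [hy, hφe]; nlinarith
    have hcosh : Real.cosh (τ / 2) ≤ y := by
      refine (Real.cosh_le_exp_half_sq _).trans (le_trans ?_ hy1)
      have hx := Real.exp_bound_div_one_sub_of_interval (x := (τ / 2) ^ 2 / 2) (by positivity)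
        (by nlinarith)
      refine hx.trans ?_
      rw [div_le_iff₀ (by nlinarith)]
      nlinarith [sq_nonneg τ, mul_pos hτ0 hτ0, mul_nonneg (sq_nonneg τ) (show 0 ≤ 1 / 4 - τ ^ 2 by nlinarith)]
    have hy2 : 1 ≤ y := by nlinarith [sq_nonneg τ]
    have hyc := Real.cosh_arcosh hy2
    have ha0 := Real.arcosh_nonneg hy2
    have hθ : τ / 2 ≤ Real.arcosh y := by
      rw [← hyc, Real.cosh_le_cosh, abs_of_pos (by linarith), abs_of_nonneg (by simpa [hyc] using ha0)] at hcosh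
      simpa [hyc] using hcosh
    have hT : (Chebyshev.T ℝ m).eval y = Real.cosh (m * Real.arcosh y) := by
      conv_lhs => rw [← hyc]
      rw [Chebyshev.T_real_cosh]; simp
    have hc : Real.exp (m * (τ / 2)) / 2 ≤ Real.cosh (m * Real.arcosh y) := by
      rw [Real.cosh_eq]
      have : Real.exp (m * (τ / 2)) ≤ Real.exp (m * Real.arcosh y) := by gcongr
      have := Real.exp_pos (-(m * Real.arcosh y))
      linarith
    rw [hT]
    calc Real.exp (m * τ) / 4 = (Real.exp (m * (τ / 2)) / 2) ^ 2 := by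
          rw [div_pow, ← Real.exp_nat_mul]; congr 1 <;> norm_num; ring
      _ ≤ _ := by gcongr


/-- Low-degree polynomial approximation of ReLU: for every `0 < τ < 1/2` and `d ≥ 7`
there is a polynomial `p` of degree at most `d` with
`|p(x) − ReLU(x)| ≤ 7 √(d/(τπ)) e^{−√(πτd/4)}` on `[−1+τ, 0]`, and
`|p(x) − ReLU(x)| ≤ τ + √(4τ/(πd)) + 6 √(d/(τπ)) e^{−√(πτd/4)}` on `(0, 1−τ]`. -/
theorem relu_poly_approx (τ : ℝ) (hτ0 : 0 < τ) (hτ : τ < 1 / 2) (d : ℕ) (hd : 7 ≤ d) :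
    ∃ p : Polynomial ℝ, p.degree ≤ d ∧
      (∀ x ∈ Set.Icc (-1 + τ) (0 : ℝ),
        |p.eval x - max x 0| ≤
          7 * Real.sqrt (d / (τ * Real.pi)) * Real.exp (-Real.sqrt (Real.pi * τ * d / 4))) ∧
      (∀ x ∈ Set.Ioc (0 : ℝ) (1 - τ),
        |p.eval x - max x 0| ≤
          τ + Real.sqrt (4 * τ / (Real.pi * d)) +
            6 * Real.sqrt (d / (τ * Real.pi)) * Real.exp (-Real.sqrt (Real.pi * τ * d / 4))) := by
  set s := Real.sqrt (Real.pi * τ * d / 4) with hs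
  have hπ := Real.pi_gt_three
  have hπ' := Real.pi_lt_d2
  have hd' : (7 : ℝ) ≤ d := by exact_mod_cast hd
  have hs0 : 0 < s := Real.sqrt_pos.2 (by positivity)
  have hs2 : s ^ 2 = Real.pi * τ * d / 4 := Real.sq_sqrt (by positivity)
  have hA : Real.sqrt (d / (τ * Real.pi)) = 2 * s / (Real.pi * τ) := by
    rw [Real.sqrt_eq_iff_mul_self_eq_of_pos (by positivity)]
    have : (2 * s / (Real.pi * τ)) * (2 * s / (Real.pi * τ)) = 4 * s ^ 2 / (Real.pi * τ) ^ 2 := by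
      ring
    rw [this, hs2]; field_simp
  have hB := Real.sqrt_nonneg (4 * τ / (Real.pi * d))
  rw [hA]
  have hE := Real.exp_pos (-s)
  have h6 : 3.8 * (s * Real.exp (-s)) / τ ≤ 6 * (2 * s / (Real.pi * τ)) * Real.exp (-s) := by
    have : 6 * (2 * s / (Real.pi * τ)) * Real.exp (-s)
      = (12 / Real.pi) * (s * Real.exp (-s)) / τ := by field_simp; ring
    rw [this]
    gcongr
    rw [le_div_iff₀ (by positivity)]; linarith
  have h7 : 6 * (2 * s / (Real.pi * τ)) * Real.exp (-s)
      ≤ 7 * (2 * s / (Real.pi * τ)) * Real.exp (-s) := by gcongr; norm_num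
  have he1 : (0.36 : ℝ) ≤ Real.exp (-1) := by
    have := Real.exp_neg_one_gt_d9; linarith
  rcases le_total s 4 with hs4 | hs4
  · -- trivial case
    have key : 1 ≤ 2 * τ + 3.8 * (s * Real.exp (-s)) / τ := by
      rcases le_total s 2 with hs2' | hs2'
      · have h2 : (0.36 : ℝ) ^ 2 ≤ Real.exp (-s) := by
          calc (0.36 : ℝ) ^ 2 ≤ Real.exp (-1) ^ 2 := by gcongr
            _ = Real.exp (-2) := by rw [← Real.exp_nat_mul]; norm_num
            _ ≤ _ := by gcongr
        have h3 : 1 ≤ 3.8 * (s * Real.exp (-s)) / τ := by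
          rw [le_div_iff₀ hτ0]
          have h4 : 5.25 * τ ≤ s ^ 2 := by
            rw [hs2]; nlinarith [mul_pos hτ0 (show (0 : ℝ) < d by linarith), mul_nonneg hτ0.le (show (0 : ℝ) ≤ d - 7 by linarith), mul_nonneg (mul_pos hτ0 (show (0 : ℝ) < d by linarith)).le (show (0 : ℝ) ≤ Real.pi - 3 by linarith)]
          have h5 : 2.625 * τ ≤ s := by nlinarith
          nlinarith [mul_le_mul_of_nonneg_left h2 hs0.le]
        linarith
      · have h2 : (0.36 : ℝ) ^ 4 ≤ Real.exp (-s) := by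
          calc (0.36 : ℝ) ^ 4 ≤ Real.exp (-1) ^ 4 := by gcongr
            _ = Real.exp (-4) := by rw [← Real.exp_nat_mul]; norm_num
            _ ≤ _ := by gcongr
        have h3 : (0.125 : ℝ) ≤ 3.8 * (s * Real.exp (-s)) := by
          have : 2 * (0.36 : ℝ) ^ 4 ≤ s * Real.exp (-s) := by gcongr
          norm_num at this ⊢; linarith
        have h4 : 0.125 / τ ≤ 3.8 * (s * Real.exp (-s)) / τ := by gcongr
        have h5 : 1 - 2 * τ ≤ 0.125 / τ := by
          rw [le_div_iff₀ hτ0]; nlinarith [sq_nonneg (4 * τ - 1)]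
        linarith
    refine ⟨0, by simp, ?_, ?_⟩
    · rintro x ⟨h1, h2⟩
      rw [max_eq_right h2]; simp; positivity
    · rintro x ⟨h1, h2⟩
      rw [max_eq_left h1.le]
      simp only [Polynomial.eval_zero, zero_sub, abs_neg, abs_of_pos h1]
      linarith
  · obtain ⟨q, hq, hq0, hq1, hq2, hq3⟩ := relu_kernel τ hτ0 hτ ((d - 2) / 4)
    obtain ⟨p, hp, hp1, hp2⟩ := relu_core τ _ hτ0 hτ (by positivity) q _ hq hq0 hq1 hq2 hq3
    set m := (d - 2) / 4 with hm
    have hmd : (d : ℝ) ≤ 4 * m + 5 := by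
      have : d ≤ 4 * m + 5 := by omega
      exact_mod_cast this
    have hms : s ≤ m * τ := by
      have h1 : τ * d ≤ 4 * (m * τ) + 2.5 := by nlinarith
      have h2 : 4 * s ^ 2 ≤ 3.15 * (τ * d) := by
        rw [hs2]; nlinarith [mul_pos hτ0 (show (0 : ℝ) < d by linarith)]
      nlinarith
    have hfin : 2 / (τ * (Real.exp (m * τ) / 4)) ≤ 3.8 * (s * Real.exp (-s)) / τ := by
      have h1 : 2 / (τ * (Real.exp (m * τ) / 4)) = 8 * Real.exp (-(m * τ)) / τ := by
        rw [Real.exp_neg]; field_simp; norm_num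
      rw [h1]
      have h2 : Real.exp (-(m * τ)) ≤ Real.exp (-s) := by gcongr
      refine div_le_div_of_nonneg_right ?_ hτ0.le
      nlinarith
    refine ⟨p, ?_, ?_, ?_⟩
    · refine Polynomial.natDegree_le_iff_degree_le.1 (hp.trans ?_)
      omega
    · intro x hx
      linarith [hp1 x hx]
    · intro x hx
      linarith [hp2 x hx]
end

section
/- (Scaled ReLU approximation) For every R > 0, 0 < τ < 1/2, and integer d ≥ 7, there exists a polynomial p_d of degree at most d such that |p_d(x) − ReLU(x)| ≤ 14R·√(d/(τπ))·e^{−√(πτd/4)} for x ∈ [−R, 0], and |p_d(x) − ReLU(x)| ≤ 2Rτ + 2R√(4τ/(πd)) + 12R√(d/(τπ))·e^{−√(πτd/4)} for x ∈ [0, R]. -/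
open Polynomial in
lemma aux_antideriv (p : Polynomial ℝ) (n : ℕ) (hp : p.natDegree ≤ n) :
    ∃ q : Polynomial ℝ, derivative q = p ∧ q.eval (-1) = 0 ∧ q.natDegree ≤ n + 1 := by
  set r : Polynomial ℝ := ∑ i ∈ Finset.range (n + 1), monomial (i + 1) (p.coeff i / ((i : ℝ) + 1))
    with hr
  have hd : derivative r = p := by
    rw [hr, derivative_sum]
    conv_rhs => rw [p.as_sum_range' (n + 1) (by omega)]
    refine Finset.sum_congr rfl fun i _ => ?_
    rw [derivative_monomial]
    have : (i : ℝ) + 1 ≠ 0 := by positivity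
    simp only [Nat.add_sub_cancel]
    congr 1
    push_cast
    field_simp
  have hn : r.natDegree ≤ n + 1 := by
    refine natDegree_sum_le_of_forall_le _ _ fun i hi => ?_
    refine (natDegree_monomial_le _).trans ?_
    have := Finset.mem_range.1 hi
    omega
  refine ⟨r - C (r.eval (-1)), ?_, ?_, ?_⟩
  · simp [hd]
  · simp
  · rw [natDegree_sub_C]; exact hn

open Polynomial in
lemma aux_mv_le (P : Polynomial ℝ) (a b c : ℝ) (hab : a ≤ b)
    (h : ∀ x ∈ Set.Icc a b, (derivative P).eval x ≤ c) :
    P.eval b - P.eval a ≤ c * (b - a) := by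
  refine (convex_Icc a b).image_sub_le_mul_sub_of_deriv_le (f := fun x => P.eval x)
    P.continuous.continuousOn P.differentiable.differentiableOn ?_ a ⟨le_rfl, hab⟩ b
    ⟨hab, le_rfl⟩ hab
  intro x hx
  rw [Polynomial.deriv]
  exact h x (interior_subset hx)

open Polynomial in
lemma aux_le_mv (P : Polynomial ℝ) (a b c : ℝ) (hab : a ≤ b)
    (h : ∀ x ∈ Set.Icc a b, c ≤ (derivative P).eval x) :
    c * (b - a) ≤ P.eval b - P.eval a := by
  have := aux_mv_le (-P) a b (-c) hab (by
    intro x hx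
    have := h x hx
    simp only [derivative_neg, eval_neg]
    linarith)
  simp only [eval_neg] at this
  linarith

lemma aux_cosh (τ : ℝ) (hτ0 : 0 < τ) (hτ : τ < 1 / 2) :
    Real.cosh τ ≤ 1 + 3 / 4 * τ ^ 2 := by
  have hz : τ ^ 2 / 2 < 1 / 8 := by nlinarith
  have hz0 : 0 < τ ^ 2 / 2 := by positivity
  refine (Real.cosh_le_exp_half_sq τ).trans ?_
  refine (Real.exp_bound_div_one_sub_of_interval hz0.le (by linarith)).trans ?_
  rw [div_le_iff₀ (by linarith)]
  nlinarith

open Polynomial in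
lemma aux_T_lower (m : ℕ) (τ y : ℝ) (hτ0 : 0 < τ) (hy : Real.cosh τ ≤ y) :
    Real.exp (m * τ) / 2 ≤ (Chebyshev.T ℝ m).eval y := by
  have h1 : 1 ≤ y := (Real.one_le_cosh τ).trans hy
  rw [← Real.cosh_arcosh h1, Chebyshev.T_real_cosh]
  rw [← Real.cosh_arcosh h1, Real.cosh_le_cosh] at hy
  have h2 : Real.cosh (m * τ) ≤ Real.cosh (((m : ℕ) : ℤ) * Real.arcosh y) := by
    rw [Real.cosh_le_cosh, abs_mul, abs_mul]
    push_cast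
    exact mul_le_mul_of_nonneg_left hy (abs_nonneg _)
  refine le_trans ?_ h2
  rw [Real.cosh_eq]
  have := Real.exp_pos (-(m * τ))
  linarith

open Polynomial in
lemma aux_unit (τ : ℝ) (hτ0 : 0 < τ) (hτ : τ < 1 / 2) (m : ℕ) :
    ∃ p : Polynomial ℝ, p.natDegree ≤ 2 * m + 2 ∧
      (∀ x ∈ Set.Icc (-1 : ℝ) 0, |p.eval x - max x 0| ≤ 4 * Real.exp (-(m * τ)) / τ) ∧
      (∀ x ∈ Set.Icc (0 : ℝ) 1, |p.eval x - max x 0| ≤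
        2 * τ + 4 * Real.exp (-(m * τ)) / τ) := by
  set K : Polynomial ℝ := 1 + (Chebyshev.T ℝ m).comp (C (1 + τ ^ 2) - (X - C τ) ^ 2) with hK
  have hKe : ∀ x, K.eval x = 1 + (Chebyshev.T ℝ m).eval (1 + τ ^ 2 - (x - τ) ^ 2) := by
    intro x; simp [hK, eval_comp]
  have hKd : K.natDegree ≤ 2 * m := by
    refine natDegree_add_le_of_degree_le (by simp) ?_
    refine natDegree_comp_le.trans ?_
    rw [Chebyshev.natDegree_T, mul_comm]
    simp only [Int.natAbs_natCast]
    refine Nat.mul_le_mul_right _ ?_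
    compute_degree
  have hK0 : ∀ x ∈ Set.Icc (-1 : ℝ) 1, 0 ≤ K.eval x := by
    rintro x ⟨h1, h2⟩
    rw [hKe]
    rcases le_total (1 + τ ^ 2 - (x - τ) ^ 2) 1 with h | h
    · have := (Chebyshev.eval_T_real_mem_Icc m
        (x := 1 + τ ^ 2 - (x - τ) ^ 2) ⟨by nlinarith, h⟩).1
      linarith
    · have := Chebyshev.one_le_eval_T_real m h
      linarith
  have hK2 : ∀ x ∈ Set.Icc (-1 : ℝ) 1, (x ≤ 0 ∨ 2 * τ ≤ x) → K.eval x ≤ 2 := by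
    rintro x ⟨h1, h2⟩ h3
    rw [hKe]
    have := (Chebyshev.eval_T_real_mem_Icc m
        (x := 1 + τ ^ 2 - (x - τ) ^ 2) ⟨by nlinarith, by rcases h3 with h | h <;> nlinarith⟩).2
    linarith
  have hKA : ∀ x ∈ Set.Icc (τ / 2) (3 * τ / 2), Real.exp (m * τ) / 2 ≤ K.eval x := by
    rintro x ⟨h1, h2⟩
    rw [hKe]
    have := aux_T_lower m τ (1 + τ ^ 2 - (x - τ) ^ 2) hτ0
      ((aux_cosh τ hτ0 hτ).trans (by nlinarith))
    linarith
  obtain ⟨F, hF, hF1, hFd⟩ := aux_antideriv K _ hKd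
  obtain ⟨G, hG, hG1, hGd⟩ := aux_antideriv F _ hFd
  have Fmono : ∀ a b, -1 ≤ a → a ≤ b → b ≤ 1 → F.eval a ≤ F.eval b := by
    intro a b h1 h2 h3
    have := aux_le_mv F a b 0 h2 (by
      intro x hx; rw [hF]; exact hK0 x ⟨h1.trans hx.1, hx.2.trans h3⟩)
    linarith
  have F0 : ∀ x ∈ Set.Icc (-1 : ℝ) 1, 0 ≤ F.eval x := by
    intro x hx
    rw [← hF1]; exact Fmono _ _ le_rfl hx.1 hx.2
  have Fneg : F.eval 0 ≤ 2 := by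
    have := aux_mv_le F (-1) 0 2 (by norm_num) (by
      intro x hx; rw [hF]
      exact hK2 x ⟨hx.1, by linarith [hx.2]⟩ (Or.inl hx.2))
    linarith
  set Z := F.eval 1 with hZ
  have Fpos : ∀ x, 2 * τ ≤ x → x ≤ 1 → Z - 2 ≤ F.eval x := by
    intro x h1 h2
    have := aux_mv_le F x 1 2 h2 (by
      intro t ht; rw [hF]
      exact hK2 t ⟨by linarith [ht.1], ht.2⟩ (Or.inr (h1.trans ht.1)))
    linarith
  have hZA : τ * (Real.exp (m * τ) / 2) ≤ Z := by
    have h1 := aux_le_mv F (τ / 2) (3 * τ / 2) (Real.exp (m * τ) / 2) (by linarith) (by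
      intro x hx; rw [hF]; exact hKA x hx)
    have h2 := Fmono (3 * τ / 2) 1 (by linarith) (by linarith) le_rfl
    have h3 := F0 (τ / 2) ⟨by linarith, by linarith⟩
    linarith
  have hA : 0 < τ * (Real.exp (m * τ) / 2) := by positivity
  have hZ0 : 0 < Z := hA.trans_le hZA
  have hE : 2 / Z ≤ 4 * Real.exp (-(m * τ)) / τ := by
    refine (div_le_div_of_nonneg_left (by norm_num) hA hZA).trans (le_of_eq ?_)
    rw [Real.exp_neg]
    field_simp
    norm_num
  have Gmono : ∀ a b, -1 ≤ a → a ≤ b → b ≤ 1 → G.eval a ≤ G.eval b := by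
    intro a b h1 h2 h3
    have := aux_le_mv G a b 0 h2 (by
      intro x hx; rw [hG]; exact F0 x ⟨h1.trans hx.1, hx.2.trans h3⟩)
    linarith
  have G0 : ∀ x ∈ Set.Icc (-1 : ℝ) 1, 0 ≤ G.eval x := by
    intro x hx
    rw [← hG1]; exact Gmono _ _ le_rfl hx.1 hx.2
  have G2 : G.eval 0 ≤ 2 := by
    have := aux_mv_le G (-1) 0 2 (by norm_num) (by
      intro x hx; rw [hG]
      exact (Fmono x 0 hx.1 hx.2 (by norm_num)).trans Fneg)
    linarith
  refine ⟨C Z⁻¹ * G, ?_, ?_, ?_⟩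
  · exact (natDegree_C_mul_le _ _).trans hGd
  · intro x hx
    rw [max_eq_right hx.2]
    have h1 := G0 x ⟨hx.1, by linarith [hx.2]⟩
    have h2 := Gmono x 0 hx.1 hx.2 (by norm_num)
    have h3 : (C Z⁻¹ * G).eval x - 0 = G.eval x / Z := by simp; ring
    rw [h3, abs_of_nonneg (by positivity)]
    refine le_trans ?_ hE
    gcongr
    linarith
  · intro x hx
    rw [max_eq_left hx.1]
    have h3 : (C Z⁻¹ * G).eval x - x = (G.eval x - Z * x) / Z := by
      simp; field_simp
    have h4 : 2 * τ + 2 / Z = (2 * τ * Z + 2) / Z := by field_simp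
    refine le_trans ?_ (add_le_add_right hE (2 * τ))
    rw [h3, h4, abs_div, abs_of_pos hZ0]
    gcongr
    rw [abs_le]
    constructor
    · rcases le_total x (2 * τ) with h | h
      · have := G0 x ⟨by linarith [hx.1], hx.2⟩
        nlinarith
      · have h5 := aux_le_mv G (2 * τ) x (Z - 2) h (by
          intro t ht; rw [hG]
          exact Fpos t ht.1 (ht.2.trans hx.2))
        have h6 := G0 (2 * τ) ⟨by linarith, by linarith⟩
        nlinarith [hx.2]
    · have h5 := aux_mv_le G 0 x Z hx.1 (by
        intro t ht; rw [hG]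
        exact Fmono t 1 (by linarith [ht.1]) (ht.2.trans hx.2) le_rfl)
      have : 0 < 2 * τ * Z := by positivity
      linarith

open Polynomial in
lemma aux_scale (R : ℝ) (hR : 0 < R) (d : ℕ) (A B : ℝ)
    (h : ∃ p : Polynomial ℝ, p.natDegree ≤ d ∧
      (∀ x ∈ Set.Icc (-1 : ℝ) 0, |p.eval x - max x 0| ≤ A) ∧
      (∀ x ∈ Set.Icc (0 : ℝ) 1, |p.eval x - max x 0| ≤ B)) :
    ∃ p : Polynomial ℝ, p.degree ≤ d ∧
      (∀ x ∈ Set.Icc (-R) (0 : ℝ), |p.eval x - max x 0| ≤ R * A) ∧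
      (∀ x ∈ Set.Icc (0 : ℝ) R, |p.eval x - max x 0| ≤ R * B) := by
  obtain ⟨p, hp, h1, h2⟩ := h
  have key : ∀ x, |(C R * p.comp (C R⁻¹ * X)).eval x - max x 0| =
      R * |p.eval (x / R) - max (x / R) 0| := by
    intro x
    have : max x 0 = R * max (x / R) 0 := by
      rw [mul_max_of_nonneg _ _ hR.le, mul_zero, mul_div_cancel₀ _ hR.ne']
    rw [this, ← abs_of_pos hR, ← abs_mul, abs_of_pos hR]
    simp only [eval_mul, eval_C, eval_comp, eval_X]
    rw [div_eq_inv_mul, mul_sub]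
  refine ⟨C R * p.comp (C R⁻¹ * X), ?_, ?_, ?_⟩
  · refine degree_le_of_natDegree_le ?_
    refine (natDegree_C_mul_le _ _).trans (natDegree_comp_le.trans ?_)
    have : (C R⁻¹ * X : Polynomial ℝ).natDegree ≤ 1 := by compute_degree
    nlinarith
  · intro x hx
    rw [key]
    refine mul_le_mul_of_nonneg_left (h1 _ ⟨?_, ?_⟩) hR.le
    · rw [le_div_iff₀ hR]; linarith [hx.1]
    · exact div_nonpos_of_nonpos_of_nonneg hx.2 hR.le
  · intro x hx
    rw [key]
    refine mul_le_mul_of_nonneg_left (h2 _ ⟨?_, ?_⟩) hR.le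
    · exact div_nonneg hx.1 hR.le
    · rw [div_le_iff₀ hR]; linarith [hx.2]


/-- Scaled ReLU approximation: for every `R > 0`, `0 < τ < 1/2`, and `d ≥ 7`, there
exists a polynomial `p_d` of degree at most `d` with
`|p_d(x) − ReLU(x)| ≤ 14R √(d/(τπ)) e^{−√(πτd/4)}` for `x ∈ [−R, 0]`, and
`|p_d(x) − ReLU(x)| ≤ 2Rτ + 2R√(4τ/(πd)) + 12R√(d/(τπ)) e^{−√(πτd/4)}` for `x ∈ [0, R]`. -/
theorem relu_poly_approx_scaled (R : ℝ) (hR : 0 < R) (τ : ℝ) (hτ0 : 0 < τ)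
    (hτ : τ < 1 / 2) (d : ℕ) (hd : 7 ≤ d) :
    ∃ p : Polynomial ℝ, p.degree ≤ d ∧
      (∀ x ∈ Set.Icc (-R) (0 : ℝ),
        |p.eval x - max x 0| ≤
          14 * R * Real.sqrt (d / (τ * Real.pi)) *
            Real.exp (-Real.sqrt (Real.pi * τ * d / 4))) ∧
      (∀ x ∈ Set.Icc (0 : ℝ) R,
        |p.eval x - max x 0| ≤
          2 * R * τ + 2 * R * Real.sqrt (4 * τ / (Real.pi * d)) +
            12 * R * Real.sqrt (d / (τ * Real.pi)) *
              Real.exp (-Real.sqrt (Real.pi * τ * d / 4))) := by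
  obtain ⟨s, hs⟩ : ∃ s, s = Real.sqrt (Real.pi * τ * d / 4) := ⟨_, rfl⟩
  have hd7 : (7 : ℝ) ≤ d := by exact_mod_cast hd
  have hpi := Real.pi_pos
  have hpi3 := Real.pi_gt_three
  have hpi4 := Real.pi_lt_d2
  have hs0 : 0 < s := by rw [hs]; positivity
  have hs2 : s ^ 2 = Real.pi * τ * d / 4 := by rw [hs]; exact Real.sq_sqrt (by positivity)
  have hq : Real.sqrt (d / (τ * Real.pi)) = 2 * s / (Real.pi * τ) := by
    rw [Real.sqrt_eq_iff_mul_self_eq (by positivity) (by positivity), ← sq]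
    rw [div_pow, mul_pow, hs2]
    field_simp
    norm_num
  rw [← hs, hq]
  have hw : 0 ≤ Real.sqrt (4 * τ / (Real.pi * d)) := Real.sqrt_nonneg _
  set w := Real.sqrt (4 * τ / (Real.pi * d))
  set E := 2 * s / (Real.pi * τ) * Real.exp (-s) with hE
  have hE0 : 0 < E := by positivity
  suffices H : ∃ p : Polynomial ℝ, p.natDegree ≤ d ∧
      (∀ x ∈ Set.Icc (-1 : ℝ) 0, |p.eval x - max x 0| ≤ 14 * E) ∧
      (∀ x ∈ Set.Icc (0 : ℝ) 1, |p.eval x - max x 0| ≤ 2 * τ + 2 * w + 12 * E) by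
    obtain ⟨p, h1, h2, h3⟩ := aux_scale R hR d _ _ H
    refine ⟨p, h1, fun x hx => (h2 x hx).trans (le_of_eq ?_),
      fun x hx => (h3 x hx).trans (le_of_eq ?_)⟩ <;> rw [hE] <;> ring
  have he : Real.exp 1 < 2.72 := by linarith [Real.exp_one_lt_d9]
  rcases le_total s 2 with h2 | h2
  · refine ⟨0, by simp, ?_, ?_⟩
    · intro x hx
      rw [max_eq_right hx.2]
      simp only [Polynomial.eval_zero, sub_zero, abs_zero]
      positivity
    · intro x hx
      rw [max_eq_left hx.1]
      have hx' : |Polynomial.eval x 0 - x| = x := by simp [abs_of_nonneg hx.1]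
      rw [hx']
      have h3 : 1 ≤ 12 * E := by
        have h4 : Real.exp s ≤ 2.72 ^ 2 := by
          calc Real.exp s ≤ Real.exp (1 + 1) := Real.exp_le_exp.2 (by linarith)
            _ = Real.exp 1 ^ 2 := by rw [Real.exp_add]; ring
            _ ≤ 2.72 ^ 2 := by gcongr
        have h5 : 12 * E = 24 * s / (Real.pi * τ * Real.exp s) := by
          rw [hE, Real.exp_neg]; field_simp; norm_num
        rw [h5, le_div_iff₀ (by positivity), one_mul]
        -- π τ ≤ 4 s² / 7
        have h6 : Real.pi * τ ≤ 4 * s ^ 2 / 7 := by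
          rw [hs2]
          have : 0 < Real.pi * τ := by positivity
          nlinarith
        calc Real.pi * τ * Real.exp s ≤ 4 * s ^ 2 / 7 * 2.72 ^ 2 := by gcongr
          _ ≤ 24 * s := by nlinarith
      linarith [hx.2]
  · obtain ⟨m, hm⟩ : ∃ m, m = (d - 2) / 2 := ⟨_, rfl⟩
    have hm1 : 2 * m + 2 ≤ d := by omega
    have hm2 : d ≤ 2 * m + 3 := by omega
    have hm3 : (d : ℝ) ≤ 2 * m + 3 := by exact_mod_cast hm2
    have hmt : s - 1 ≤ m * τ := by
      have h3 : s ^ 2 * 4 = Real.pi * (τ * d) := by rw [hs2]; ring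
      have h4 : s ^ 2 * 4 ≤ 3.15 * (τ * d) := by
        rw [h3]; have : 0 < τ * d := by positivity
        nlinarith
      nlinarith
    have h5 : 4 * Real.exp (-(m * τ)) / τ ≤ 12 * E := by
      have h6 : Real.exp (-(m * τ)) ≤ 2.72 * Real.exp (-s) := by
        calc Real.exp (-(m * τ)) ≤ Real.exp (1 + -s) := Real.exp_le_exp.2 (by linarith)
          _ = Real.exp 1 * Real.exp (-s) := Real.exp_add _ _
          _ ≤ _ := by gcongr
      have h7 : 12 * E = (24 * s / Real.pi * Real.exp (-s)) / τ := by
        rw [hE]; field_simp; norm_num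
      rw [h7]
      refine div_le_div_of_nonneg_right ?_ hτ0.le
      have h8 : 4 * 2.72 ≤ 24 * s / Real.pi := by
        rw [le_div_iff₀ hpi]; nlinarith
      calc 4 * Real.exp (-(m * τ)) ≤ 4 * 2.72 * Real.exp (-s) := by linarith
        _ ≤ _ := by gcongr
    obtain ⟨p, p1, p2, p3⟩ := aux_unit τ hτ0 hτ m
    exact ⟨p, p1.trans hm1, fun x hx => (p2 x hx).trans (by linarith),
      fun x hx => (p3 x hx).trans (by linarith)⟩
end

section
/- (No mixed monomials for the optimal polynomial estimator) Let X = AZ + ξ where A is an m×m orthogonal matrix, Z has independent coordinates, and ξ ~ N(0, σ²I) independent of Z. Among all multivariate polynomials f of degree at most d, there is a unique minimizer f* of E[(f(AᵀX) − ⟨w, Z⟩)²], and f* can be written as f*(x) = Σᵢ fᵢ*(xᵢ) where each fᵢ* is a univariate polynomial of degree at most d (i.e., f* contains no mixed monomials). -/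
open Matrix MeasureTheory ProbabilityTheory NNReal

def AllLp {Ω : Type*} [MeasurableSpace Ω] (μ : Measure Ω) (f : Ω → ℝ) : Prop :=
  ∀ n : ℕ, MemLp f n μ

namespace AllLp
variable {Ω : Type*} [MeasurableSpace Ω] {μ : Measure Ω} {f g : Ω → ℝ}

theorem add (hf : AllLp μ f) (hg : AllLp μ g) : AllLp μ (fun x => f x + g x) :=
  fun n => (hf n).add (hg n)

theorem mul (hf : AllLp μ f) (hg : AllLp μ g) : AllLp μ (fun x => f x * g x) := by
  intro n
  have : ENNReal.HolderTriple ((2 * n : ℕ) : ENNReal) ((2 * n : ℕ) : ENNReal) (n : ENNReal) := by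
    constructor
    push_cast
    rw [ENNReal.mul_inv (by simp) (by simp), ← add_mul, ENNReal.inv_two_add_inv_two, one_mul]
  exact (hg (2 * n)).mul' (hf (2 * n))

theorem const [IsFiniteMeasure μ] (c : ℝ) : AllLp μ (fun _ => c) := fun _ => memLp_const c

theorem sub (hf : AllLp μ f) (hg : AllLp μ g) : AllLp μ (fun x => f x - g x) :=
  fun n => (hf n).sub (hg n)

theorem pow [IsFiniteMeasure μ] (hf : AllLp μ f) (k : ℕ) : AllLp μ (fun x => f x ^ k) := by
  induction k with
  | zero => simpa using const 1
  | succ k ih => simpa only [pow_succ] using ih.mul hf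

theorem sum [IsFiniteMeasure μ] {ι : Type*} (s : Finset ι) (F : ι → Ω → ℝ)
    (h : ∀ i ∈ s, AllLp μ (F i)) : AllLp μ (fun x => ∑ i ∈ s, F i x) := 
  fun n => memLp_finsetSum s fun i hi => h i hi n

theorem prod [IsFiniteMeasure μ] {ι : Type*} (s : Finset ι) (F : ι → Ω → ℝ)
    (h : ∀ i ∈ s, AllLp μ (F i)) : AllLp μ (fun x => ∏ i ∈ s, F i x) := by
  classical
  induction s using Finset.induction_on with
  | empty => simpa using const 1
  | insert a s ha ih =>
    simp only [Finset.prod_insert ha]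
    exact (h a (by simp)).mul (ih fun i hi => h i (by simp [hi]))

theorem integrable (hf : AllLp μ f) : Integrable f μ := by
  simpa [memLp_one_iff_integrable] using hf 1

theorem poly [IsFiniteMeasure μ] (hf : AllLp μ f) (q : Polynomial ℝ) :
    AllLp μ (fun x => q.eval (f x)) := by
  simp only [Polynomial.eval_eq_sum, Polynomial.sum]
  exact sum _ _ fun i _ => (const _).mul (hf.pow _)

theorem mvpoly [IsFiniteMeasure μ] {ι : Type*} {F : Ω → ι → ℝ} (hf : ∀ i, AllLp μ (fun x => F x i))
    (q : MvPolynomial ι ℝ) : AllLp μ (fun x => MvPolynomial.eval (F x) q) := by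
  simp only [MvPolynomial.eval_eq]
  exact sum _ _ fun i _ => (const _).mul (prod _ _ fun j _ => (hf j).pow _)

theorem comp {Ω' : Type*} [MeasurableSpace Ω'] {μ' : Measure Ω'} {φ : Ω' → Ω} (hf : AllLp μ f)
    (hφ : MeasurePreserving φ μ' μ) : AllLp μ' (fun x => f (φ x)) :=
  fun n => (hf n).comp_measurePreserving hφ

theorem of_moments {ν : Measure ℝ} [IsProbabilityMeasure ν]
    (h : ∀ p : ℕ, Integrable (fun x : ℝ => |x| ^ p) ν) : AllLp ν (fun x => x) := by
  intro n
  rcases Nat.eq_zero_or_pos n with rfl | hn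
  · rw [Nat.cast_zero, memLp_zero_iff_aestronglyMeasurable]
    exact measurable_id.aestronglyMeasurable
  · rw [← integrable_norm_rpow_iff (f := fun x : ℝ => x) aestronglyMeasurable_id
      (by simpa using hn.ne') (by simp)]
    simpa using h n

theorem gauss (v : ℝ≥0) : AllLp (gaussianReal 0 v) (fun x => x) :=
  fun n => memLp_id_gaussianReal' n (by simp)
end AllLp

theorem gauss_openPos {v : ℝ≥0} (hv : v ≠ 0) : (gaussianReal 0 v).IsOpenPosMeasure :=
  (gaussianReal_absolutelyContinuous' 0 hv).isOpenPosMeasure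

theorem eq_zero_of_conv {E : Type*} [TopologicalSpace E] [AddCommGroup E] [IsTopologicalAddGroup E]
    [MeasurableSpace E] {μ γ : Measure E} [IsProbabilityMeasure μ] [IsProbabilityMeasure γ]
    [γ.IsOpenPosMeasure] {h : E → ℝ} (hc : Continuous h)
    (hi : Integrable (fun p : E × E => h (p.1 + p.2) ^ 2) (μ.prod γ))
    (h0 : ∫ p : E × E, h (p.1 + p.2) ^ 2 ∂(μ.prod γ) = 0) (x : E) : h x = 0 := by
  rw [integral_eq_zero_iff_of_nonneg (fun p => sq_nonneg _) hi] at h0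
  have h1 := Measure.ae_ae_of_ae_prod h0
  obtain ⟨z, hz⟩ := h1.exists
  have h2 : (fun y => h (z + y) ^ 2) = fun _ => (0 : ℝ) :=
    (Continuous.ae_eq_iff_eq γ (by fun_prop) (by fun_prop)).1 hz
  simpa using congrFun h2 (x - z)

theorem uni (d : ℕ) {ν : Measure ℝ} [IsProbabilityMeasure ν] (hm : AllLp ν (fun x => x))
    {v : ℝ≥0} (hv : v ≠ 0) (c : ℝ) :
    ∃ f : Polynomial ℝ, f.natDegree ≤ d ∧ ∀ q : Polynomial ℝ, q.natDegree ≤ d →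
      ∫ p : ℝ × ℝ, (f.eval (p.1 + p.2) - c * p.1) * q.eval (p.1 + p.2)
        ∂(ν.prod (gaussianReal 0 v)) = 0 := by
  have := gauss_openPos hv
  set μ := ν.prod (gaussianReal 0 v) with hμ
  have hz : AllLp μ (fun p : ℝ × ℝ => p.1) := hm.comp measurePreserving_fst
  have hu : AllLp μ (fun p : ℝ × ℝ => p.1 + p.2) :=
    hz.add ((AllLp.gauss v).comp measurePreserving_snd)
  let V := Polynomial.degreeLT ℝ (d + 1)
  have hV : ∀ q : Polynomial ℝ, q ∈ V ↔ q.natDegree ≤ d := fun q => by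
    rw [Polynomial.mem_degreeLT, ← Nat.lt_succ_iff]
    constructor
    · intro h
      by_cases h0 : q = 0
      · simp [h0]
      · exact (Polynomial.natDegree_lt_iff_degree_lt h0).2 h
    · intro h
      by_cases h0 : q = 0
      · simp [h0]
      · exact (Polynomial.natDegree_lt_iff_degree_lt h0).1 h
  have : FiniteDimensional ℝ V := Module.Finite.equiv (Polynomial.degreeLTEquiv ℝ (d + 1)).symm
  let B : V →ₗ[ℝ] Module.Dual ℝ V := LinearMap.mk₂ ℝ
    (fun f q => ∫ p : ℝ × ℝ, f.1.eval (p.1 + p.2) * q.1.eval (p.1 + p.2) ∂μ)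
    (by
      intro f g q
      rw [← integral_add ((hu.poly _).mul (hu.poly _)).integrable
        ((hu.poly _).mul (hu.poly _)).integrable]
      simp [add_mul])
    (by
      intro a f q
      simp [← integral_const_mul, mul_assoc])
    (by
      intro f g q
      rw [← integral_add ((hu.poly _).mul (hu.poly _)).integrable
        ((hu.poly _).mul (hu.poly _)).integrable]
      simp [mul_add])
    (by
      intro a f q
      simp [← integral_const_mul, mul_left_comm])
  let L : Module.Dual ℝ V :=
    { toFun := fun q => ∫ p : ℝ × ℝ, (c * p.1) * q.1.eval (p.1 + p.2) ∂μ
      map_add' := by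
        intro f g
        rw [← integral_add (((AllLp.const c).mul hz).mul (hu.poly _)).integrable
          (((AllLp.const c).mul hz).mul (hu.poly _)).integrable]
        simp [mul_add]
      map_smul' := by
        intro a f
        simp [← integral_const_mul, mul_left_comm] }
  have hinj : Function.Injective B := by
    rw [← LinearMap.ker_eq_bot, LinearMap.ker_eq_bot']
    intro f hf
    have h1 : B f f = 0 := by rw [hf]; rfl
    have h2 : ∫ p : ℝ × ℝ, f.1.eval (p.1 + p.2) ^ 2 ∂μ = 0 := by
      rw [← h1]; simp [B, sq]
    ext1
    apply Polynomial.funext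
    intro x
    simpa using eq_zero_of_conv (μ := ν) (γ := gaussianReal 0 v) (h := fun x => f.1.eval x)
      (by fun_prop) ((hu.poly _).pow 2).integrable h2 x
  have hsurj : Function.Surjective B :=
    (LinearMap.injective_iff_surjective_of_finrank_eq_finrank
      (Subspace.dual_finrank_eq (K := ℝ) (V := V)).symm).1 hinj
  obtain ⟨f, hf⟩ := hsurj L
  refine ⟨f.1, (hV _).1 f.2, fun q hq => ?_⟩
  have h1 : B f ⟨q, (hV q).2 hq⟩ = L ⟨q, (hV q).2 hq⟩ := by rw [hf]
  simp only [sub_mul]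
  rw [integral_sub ((hu.poly _).mul (hu.poly _)).integrable
    (((AllLp.const c).mul hz).mul (hu.poly _)).integrable, sub_eq_zero]
  exact h1

theorem rot {m : ℕ} (A : Matrix (Fin m) (Fin m) ℝ) (hA : Aᵀ * A = 1) (v : ℝ≥0) :
    MeasurePreserving (fun x : Fin m → ℝ => Aᵀ.mulVec x)
      (Measure.pi fun _ : Fin m => gaussianReal 0 v) (Measure.pi fun _ : Fin m => gaussianReal 0 v) := by
  have hmeas : Measurable (fun x : Fin m → ℝ => Aᵀ.mulVec x) :=
    (Continuous.matrix_mulVec continuous_const continuous_id).measurable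
  refine ⟨hmeas, ?_⟩
  set P := (Measure.pi fun _ : Fin m => gaussianReal 0 v) with hP
  have key : (P.map (fun x : Fin m → ℝ => Aᵀ.mulVec x)).map (WithLp.toLp 2) = P.map (WithLp.toLp 2) := by
    have : IsProbabilityMeasure (P.map (fun x : Fin m → ℝ => Aᵀ.mulVec x)) :=
      Measure.isProbabilityMeasure_map hmeas.aemeasurable
    have e1 : IsProbabilityMeasure ((P.map (fun x : Fin m → ℝ => Aᵀ.mulVec x)).map (WithLp.toLp 2)) :=
      Measure.isProbabilityMeasure_map (by fun_prop)
    have e2 : IsProbabilityMeasure (P.map (WithLp.toLp 2)) :=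
      Measure.isProbabilityMeasure_map (by fun_prop)
    apply Measure.ext_of_charFun (E := EuclideanSpace ℝ (Fin m))
    ext t
    have h1 : charFun ((P.map (fun x : Fin m → ℝ => Aᵀ.mulVec x)).map (WithLp.toLp 2)) t =
        charFun (P.map (WithLp.toLp 2)) (WithLp.toLp 2 (A.mulVec t.ofLp)) := by
      rw [charFun_apply, charFun_apply, Measure.map_map (by fun_prop) hmeas,
        integral_map (by fun_prop) (by fun_prop), integral_map (by fun_prop) (by fun_prop)]
      congr 1
      ext x
      congr 3
      simp only [Function.comp, EuclideanSpace.inner_eq_star_dotProduct, star_trivial]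
      rw [Matrix.mulVec_transpose, dotProduct_comm, ← Matrix.dotProduct_mulVec, dotProduct_comm]
    have h2 : ∀ s : EuclideanSpace ℝ (Fin m), charFun (P.map (WithLp.toLp 2)) s =
        Complex.exp (- (v * (s.ofLp ⬝ᵥ s.ofLp : ℝ) / 2)) := by
      intro s
      rw [hP, charFun_pi]
      simp_rw [charFun_gaussianReal, ← Complex.exp_sum]
      congr 1
      simp [dotProduct, Finset.mul_sum, Finset.sum_div, sq]
    rw [h1, h2, h2]
    congr 4
    simp only
    rw [Matrix.dotProduct_mulVec, Matrix.vecMul_mulVec, hA]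
    simp
  have h3 := congrArg (Measure.map (WithLp.ofLp)) key
  have h4 : ∀ Q : Measure (Fin m → ℝ), (Q.map (WithLp.toLp 2)).map WithLp.ofLp = Q := by
    intro Q
    rw [Measure.map_map (by fun_prop) (by fun_prop)]
    exact Measure.map_id
  rwa [h4, h4] at h3

theorem integral_prod_pi {m : ℕ} {ν : Fin m → Measure ℝ} {γ : Measure ℝ}
    [∀ i, IsProbabilityMeasure (ν i)] [IsProbabilityMeasure γ] (H : Fin m → ℝ × ℝ → ℝ)
    (hH : ∀ j, Integrable (H j) ((ν j).prod γ))
    (hI : Integrable (fun p : (Fin m → ℝ) × (Fin m → ℝ) => ∏ j, H j (p.1 j, p.2 j))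
      ((Measure.pi ν).prod (Measure.pi fun _ : Fin m => γ))) :
    ∫ p : (Fin m → ℝ) × (Fin m → ℝ), ∏ j, H j (p.1 j, p.2 j)
      ∂((Measure.pi ν).prod (Measure.pi fun _ : Fin m => γ)) =
    ∏ j, ∫ p, H j p ∂((ν j).prod γ) := by
  rw [integral_prod _ hI]
  have h1 : ∀ z : Fin m → ℝ, ∫ y : Fin m → ℝ, ∏ j, H j (z j, y j) ∂(Measure.pi fun _ : Fin m => γ)
      = ∏ j, ∫ y, H j (z j, y) ∂γ := fun z =>
    integral_fintype_prod_eq_prod (fun j y => H j (z j, y))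
  simp only [h1]
  rw [integral_fintype_prod_eq_prod (fun j z => ∫ y, H j (z, y) ∂γ)]
  exact Finset.prod_congr rfl fun j _ => (integral_prod _ (hH j)).symm

theorem main_reduced (m d : ℕ) (v : ℝ≥0) (hv : v ≠ 0)
    (ν : Fin m → Measure ℝ) [∀ i, IsProbabilityMeasure (ν i)]
    (hmom : ∀ i, AllLp (ν i) (fun x => x)) (w : Fin m → ℝ) :
    ∃ fstar : MvPolynomial (Fin m) ℝ, fstar.totalDegree ≤ d ∧
      (∀ s ∈ fstar.support, s.support.card ≤ 1) ∧
      ∀ g : MvPolynomial (Fin m) ℝ, g.totalDegree ≤ d →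
        (∫ p : (Fin m → ℝ) × (Fin m → ℝ), (MvPolynomial.eval (p.1 + p.2) fstar -
            ∑ i, w i * p.1 i) ^ 2
            ∂((Measure.pi ν).prod (Measure.pi fun _ : Fin m => gaussianReal 0 v))) ≤
          (∫ p : (Fin m → ℝ) × (Fin m → ℝ), (MvPolynomial.eval (p.1 + p.2) g -
            ∑ i, w i * p.1 i) ^ 2
            ∂((Measure.pi ν).prod (Measure.pi fun _ : Fin m => gaussianReal 0 v))) ∧
        ((∫ p : (Fin m → ℝ) × (Fin m → ℝ), (MvPolynomial.eval (p.1 + p.2) g -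
            ∑ i, w i * p.1 i) ^ 2
            ∂((Measure.pi ν).prod (Measure.pi fun _ : Fin m => gaussianReal 0 v))) ≤
          (∫ p : (Fin m → ℝ) × (Fin m → ℝ), (MvPolynomial.eval (p.1 + p.2) fstar -
            ∑ i, w i * p.1 i) ^ 2
            ∂((Measure.pi ν).prod (Measure.pi fun _ : Fin m => gaussianReal 0 v))) →
          g = fstar) := by
  classical
  have := gauss_openPos hv
  set γ := gaussianReal 0 v with hγ
  set μ := (Measure.pi ν).prod (Measure.pi fun _ : Fin m => γ) with hμ
  choose f hfd hf using fun i => uni d (hmom i) hv (w i)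
  have hz : ∀ i, AllLp μ (fun p => p.1 i) := fun i =>
    ((hmom i).comp (measurePreserving_eval ν i)).comp measurePreserving_fst
  have hy : ∀ i, AllLp μ (fun p => p.2 i) := fun i =>
    ((AllLp.gauss v).comp (measurePreserving_eval (fun _ : Fin m => γ) i)).comp
      measurePreserving_snd
  have hu : ∀ i, AllLp μ (fun p => (p.1 + p.2) i) := fun i => (hz i).add (hy i)
  have hu' : ∀ i, AllLp μ (fun p => p.1 i + p.2 i) := fun i => (hz i).add (hy i)
  have hz1 : ∀ i, AllLp ((ν i).prod γ) (fun p : ℝ × ℝ => p.1) := fun i =>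
    (hmom i).comp measurePreserving_fst
  have hu1 : ∀ i, AllLp ((ν i).prod γ) (fun p : ℝ × ℝ => p.1 + p.2) := fun i =>
    (hz1 i).add ((AllLp.gauss v).comp measurePreserving_snd)
  let F : MvPolynomial (Fin m) ℝ :=
    ∑ i, ∑ k ∈ Finset.range (d + 1), MvPolynomial.monomial (Finsupp.single i k) ((f i).coeff k)
  have hFe : ∀ x, MvPolynomial.eval x F = ∑ i, (f i).eval (x i) := by
    intro x
    simp only [F, map_sum, MvPolynomial.eval_monomial]
    refine Finset.sum_congr rfl fun i _ => ?_
    rw [Polynomial.eval_eq_sum_range' (Nat.lt_succ_of_le (hfd i))]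
    simp
  have hFd : F.totalDegree ≤ d := by
    refine MvPolynomial.totalDegree_finsetSum_le fun i _ =>
      MvPolynomial.totalDegree_finsetSum_le fun k hk => ?_
    refine (MvPolynomial.totalDegree_monomial_le _ _).trans ?_
    have := Finset.mem_range.1 hk
    simp; omega
  have hFs : ∀ s ∈ F.support, s.support.card ≤ 1 := by
    intro s hs
    have h1 := MvPolynomial.support_sum hs
    simp only [Finset.mem_biUnion] at h1
    obtain ⟨i, _, h1⟩ := h1
    have h2 := MvPolynomial.support_sum h1
    simp only [Finset.mem_biUnion] at h2
    obtain ⟨k, _, h2⟩ := h2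
    have h3 := MvPolynomial.support_monomial_subset h2
    rw [Finset.mem_singleton] at h3
    rw [h3]
    exact (Finset.card_le_card Finsupp.support_single_subset).trans (by simp)
  -- orthogonality against monomials
  have hmon : ∀ (i : Fin m) (s : Fin m →₀ ℕ), s i ≤ d →
      ∫ p : (Fin m → ℝ) × (Fin m → ℝ), ((f i).eval (p.1 i + p.2 i) - w i * p.1 i) *
        ∏ j, (p.1 j + p.2 j) ^ s j ∂μ = 0 := by
    intro i s hs
    let H : Fin m → ℝ × ℝ → ℝ := fun j p =>
      (if j = i then (f i).eval (p.1 + p.2) - w i * p.1 else 1) * (p.1 + p.2) ^ s j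
    have e : (fun p : (Fin m → ℝ) × (Fin m → ℝ) =>
        ((f i).eval (p.1 i + p.2 i) - w i * p.1 i) * ∏ j, (p.1 j + p.2 j) ^ s j) =
        fun p => ∏ j, H j (p.1 j, p.2 j) := by
      ext p
      simp only [H, Finset.prod_mul_distrib]
      simp
    have hint : Integrable (fun p : (Fin m → ℝ) × (Fin m → ℝ) => ∏ j, H j (p.1 j, p.2 j)) μ := by
      rw [← e]
      exact ((((hu' i).poly _).sub ((AllLp.const _).mul (hz i))).mul
        (AllLp.prod _ _ fun j _ => (hu' j).pow _)).integrable
    rw [e, integral_prod_pi H ?_ hint]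
    · refine Finset.prod_eq_zero (Finset.mem_univ i) ?_
      have := hf i (Polynomial.X ^ s i) (by simpa using hs)
      simpa [H] using this
    · intro j
      by_cases hj : j = i
      · subst hj
        simp only [H, if_true]
        exact ((((hu1 j).poly _).sub ((AllLp.const _).mul (hz1 j))).mul ((hu1 j).pow _)).integrable
      · simp only [H, if_neg hj]
        exact ((AllLp.const _).mul ((hu1 j).pow _)).integrable
  have hT : AllLp μ (fun p => ∑ i, w i * p.1 i) :=
    AllLp.sum _ _ fun i _ => (AllLp.const _).mul (hz i)
  have horth : ∀ g : MvPolynomial (Fin m) ℝ, g.totalDegree ≤ d →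
      ∫ p : (Fin m → ℝ) × (Fin m → ℝ), (MvPolynomial.eval (p.1 + p.2) F - ∑ i, w i * p.1 i) *
        MvPolynomial.eval (p.1 + p.2) g ∂μ = 0 := by
    intro g hg
    have e : ∀ p : (Fin m → ℝ) × (Fin m → ℝ),
        (MvPolynomial.eval (p.1 + p.2) F - ∑ i, w i * p.1 i) * MvPolynomial.eval (p.1 + p.2) g =
        ∑ i, ∑ s ∈ g.support, g.coeff s * (((f i).eval (p.1 i + p.2 i) - w i * p.1 i) *
          ∏ j, (p.1 j + p.2 j) ^ s j) := by
      intro p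
      rw [hFe, ← Finset.sum_sub_distrib, MvPolynomial.eval_eq', Finset.sum_mul]
      refine Finset.sum_congr rfl fun i _ => ?_
      rw [Finset.mul_sum]
      refine Finset.sum_congr rfl fun s _ => ?_
      simp only [Pi.add_apply]
      ring
    have hA : ∀ (i : Fin m) (s : Fin m →₀ ℕ), AllLp μ (fun p => g.coeff s *
        (((f i).eval (p.1 i + p.2 i) - w i * p.1 i) * ∏ j, (p.1 j + p.2 j) ^ s j)) := fun i s =>
      (AllLp.const _).mul ((((hu' i).poly _).sub ((AllLp.const _).mul (hz i))).mul
        (AllLp.prod _ _ fun j _ => (hu' j).pow _))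
    simp only [e]
    rw [integral_finsetSum _ fun i _ => (AllLp.sum _ _ fun s _ => hA i s).integrable]
    refine Finset.sum_eq_zero fun i _ => ?_
    rw [integral_finsetSum _ fun s _ => (hA i s).integrable]
    refine Finset.sum_eq_zero fun s hs => ?_
    rw [integral_const_mul, hmon i s, mul_zero]
    refine le_trans ?_ ((MvPolynomial.le_totalDegree hs).trans hg)
    by_cases hi : i ∈ s.support
    · exact Finset.single_le_sum (f := fun j => s j) (fun _ _ => Nat.zero_le _) hi
    · simp [Finsupp.notMem_support_iff.1 hi]
  refine ⟨F, hFd, hFs, fun g hg => ?_⟩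
  have hgd : (g - F).totalDegree ≤ d :=
    (MvPolynomial.totalDegree_sub _ _).trans (max_le hg hFd)
  have hR : AllLp μ (fun p => MvPolynomial.eval (p.1 + p.2) F - ∑ i, w i * p.1 i) :=
    (AllLp.mvpoly hu F).sub hT
  have hD : AllLp μ (fun p => MvPolynomial.eval (p.1 + p.2) (g - F)) := AllLp.mvpoly hu _
  have hpyth : ∫ p : (Fin m → ℝ) × (Fin m → ℝ),
      (MvPolynomial.eval (p.1 + p.2) g - ∑ i, w i * p.1 i) ^ 2 ∂μ =
      ∫ p : (Fin m → ℝ) × (Fin m → ℝ),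
      (MvPolynomial.eval (p.1 + p.2) F - ∑ i, w i * p.1 i) ^ 2 ∂μ +
      ∫ p : (Fin m → ℝ) × (Fin m → ℝ), MvPolynomial.eval (p.1 + p.2) (g - F) ^ 2 ∂μ := by
    have h0 := horth _ hgd
    have h1 : ∀ p : (Fin m → ℝ) × (Fin m → ℝ),
        (MvPolynomial.eval (p.1 + p.2) g - ∑ i, w i * p.1 i) ^ 2 =
        ((MvPolynomial.eval (p.1 + p.2) F - ∑ i, w i * p.1 i) ^ 2 +
        MvPolynomial.eval (p.1 + p.2) (g - F) ^ 2) +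
        2 * ((MvPolynomial.eval (p.1 + p.2) F - ∑ i, w i * p.1 i) *
          MvPolynomial.eval (p.1 + p.2) (g - F)) := by
      intro p
      rw [map_sub]
      ring
    simp only [h1]
    rw [integral_add ((hR.pow 2).add (hD.pow 2)).integrable
      ((AllLp.const 2).mul (hR.mul hD)).integrable,
      integral_add (hR.pow 2).integrable (hD.pow 2).integrable, integral_const_mul, h0]
    ring
  have hnn : 0 ≤ ∫ p : (Fin m → ℝ) × (Fin m → ℝ), MvPolynomial.eval (p.1 + p.2) (g - F) ^ 2 ∂μ :=
    integral_nonneg fun p => sq_nonneg _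
  refine ⟨by linarith, fun hle => ?_⟩
  have h0 : ∫ p : (Fin m → ℝ) × (Fin m → ℝ), MvPolynomial.eval (p.1 + p.2) (g - F) ^ 2 ∂μ = 0 := by
    linarith
  rw [← sub_eq_zero]
  apply MvPolynomial.funext
  intro x
  simpa using eq_zero_of_conv (μ := Measure.pi ν) (γ := Measure.pi fun _ : Fin m => γ)
    (h := fun x => MvPolynomial.eval x (g - F)) (MvPolynomial.continuous_eval _)
    (hD.pow 2).integrable h0 x

/-- No mixed monomials for the optimal polynomial estimator: with `X = AZ + ξ`,
`A` orthogonal `m × m`, `Z` with independent coordinates (a product measure with all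
moments finite), `ξ ~ N(0, σ²I)` independent of `Z`, among all multivariate
polynomials of total degree at most `d` there is a unique minimizer `fstar` of
`E[(f(AᵀX) − ⟨w, Z⟩)²]`, and every monomial of `fstar` involves at most one
variable (no mixed monomials). -/
theorem no_mixed_monomials (m d : ℕ) (hm : 0 < m)
    (A : Matrix (Fin m) (Fin m) ℝ) (hA : Aᵀ * A = 1)
    (σ : ℝ≥0) (hσ : 0 < σ)
    (ν : Fin m → Measure ℝ) (hν : ∀ i, IsProbabilityMeasure (ν i))
    (hmom : ∀ i (p : ℕ), Integrable (fun x : ℝ => |x| ^ p) (ν i))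
    (w : Fin m → ℝ) :
    ∃ fstar : MvPolynomial (Fin m) ℝ,
      (fstar.totalDegree ≤ d ∧
        (∀ g : MvPolynomial (Fin m) ℝ, g.totalDegree ≤ d →
          (∫ p : (Fin m → ℝ) × (Fin m → ℝ),
              (MvPolynomial.eval (fun i => Aᵀ.mulVec (A.mulVec p.1 + p.2) i) fstar -
                ∑ i, w i * p.1 i) ^ 2
            ∂((Measure.pi ν).prod (Measure.pi fun _ : Fin m => gaussianReal 0 (σ ^ 2)))) ≤
          (∫ p : (Fin m → ℝ) × (Fin m → ℝ),
              (MvPolynomial.eval (fun i => Aᵀ.mulVec (A.mulVec p.1 + p.2) i) g -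
                ∑ i, w i * p.1 i) ^ 2
            ∂((Measure.pi ν).prod (Measure.pi fun _ : Fin m => gaussianReal 0 (σ ^ 2))))) ∧
        ∀ s ∈ fstar.support, s.support.card ≤ 1) ∧
      ∀ g : MvPolynomial (Fin m) ℝ, g.totalDegree ≤ d →
        (∀ g' : MvPolynomial (Fin m) ℝ, g'.totalDegree ≤ d →
          (∫ p : (Fin m → ℝ) × (Fin m → ℝ),
              (MvPolynomial.eval (fun i => Aᵀ.mulVec (A.mulVec p.1 + p.2) i) g -
                ∑ i, w i * p.1 i) ^ 2
            ∂((Measure.pi ν).prod (Measure.pi fun _ : Fin m => gaussianReal 0 (σ ^ 2)))) ≤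
          (∫ p : (Fin m → ℝ) × (Fin m → ℝ),
              (MvPolynomial.eval (fun i => Aᵀ.mulVec (A.mulVec p.1 + p.2) i) g' -
                ∑ i, w i * p.1 i) ^ 2
            ∂((Measure.pi ν).prod (Measure.pi fun _ : Fin m => gaussianReal 0 (σ ^ 2))))) →
        g = fstar := by
  have hv : σ ^ 2 ≠ 0 := (pow_pos hσ 2).ne'
  obtain ⟨F, hFd, hFs, hF⟩ := main_reduced m d (σ ^ 2) hv ν
    (fun i => AllLp.of_moments (hmom i)) w
  have hred : ∀ g : MvPolynomial (Fin m) ℝ,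
      (∫ p : (Fin m → ℝ) × (Fin m → ℝ),
        (MvPolynomial.eval (fun i => Aᵀ.mulVec (A.mulVec p.1 + p.2) i) g -
          ∑ i, w i * p.1 i) ^ 2
        ∂((Measure.pi ν).prod (Measure.pi fun _ : Fin m => gaussianReal 0 (σ ^ 2)))) =
      (∫ p : (Fin m → ℝ) × (Fin m → ℝ), (MvPolynomial.eval (p.1 + p.2) g -
        ∑ i, w i * p.1 i) ^ 2
        ∂((Measure.pi ν).prod (Measure.pi fun _ : Fin m => gaussianReal 0 (σ ^ 2)))) := by
    intro g
    have hmp := (MeasurePreserving.id (Measure.pi ν)).prod (rot A hA (σ ^ 2))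
    conv_rhs => rw [← hmp.map_eq]
    have hcont : Continuous (fun p : (Fin m → ℝ) × (Fin m → ℝ) =>
        (MvPolynomial.eval (p.1 + p.2) g - ∑ i, w i * p.1 i) ^ 2) := by
      have := (MvPolynomial.continuous_eval g).comp
        (continuous_fst.add continuous_snd : Continuous
          (fun p : (Fin m → ℝ) × (Fin m → ℝ) => p.1 + p.2))
      exact (this.sub (by fun_prop)).pow 2
    rw [integral_map hmp.measurable.aemeasurable hcont.aestronglyMeasurable]
    congr 1
    ext p
    simp [Matrix.mulVec_add, Matrix.mulVec_mulVec, hA, Prod.map]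
    rfl
  simp only [hred]
  exact ⟨F, ⟨hFd, fun g hg => (hF g hg).1, hFs⟩, fun g hg h => (hF g hg).2 (h F hFd)⟩
end
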